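/- arXiv:1006.5858 — 4 statements merged into one kernel-verified Lean document; each statement's English description precedes it below -/
import Mathlib

section
/- Let T_0 = s^{−1}ts. For every g ∈ Sp(2n,q), the 'membership test' identity T_0^{(T_0^g)} = T_0 (i.e. T_0 commutes with g^{−1}T_0 g) holds if and only if the matrix entry g_{1,2n} = 0, that is, if and only if the coefficient of f_1 in the image of e_1 under g vanishes. -/
open Matrix

/-- The Gram matrix of the standard alternating form on `F^(2n)` with respect to the basis
`e_1, …, e_n, f_n, …, f_1` (so `e_i` is the `i`-th, i.e. index `i-1`, and `f_i` the
`(2n+1-i)`-th, i.e. index `2n-i`, standard basis vector):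
`⟨e_i, f_j⟩ = δ_{ij}`, `⟨f_j, e_i⟩ = -δ_{ij}`, all other pairings of basis vectors are `0`. -/
def formMatrix (F : Type) [Field F] (n : ℕ) : Matrix (Fin (2*n)) (Fin (2*n)) F :=
  Matrix.of fun i j =>
    if (i : ℕ) + (j : ℕ) = 2*n - 1 then (if (i : ℕ) < n then (1 : F) else -1) else 0

/-- The alternating bilinear form `⟨v, w⟩` on row vectors. -/
def symForm (F : Type) [Field F] (n : ℕ) (v w : Fin (2*n) → F) : F :=
  v ⬝ᵥ (formMatrix F n) *ᵥ w

/-- `M ∈ Sp(2n, q)`: a `2n × 2n` matrix over `F`, acting on row vectors on the right,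
preserving the alternating form. -/
def IsSymplectic (F : Type) [Field F] (n : ℕ) (M : Matrix (Fin (2*n)) (Fin (2*n)) F) : Prop :=
  ∀ v w : Fin (2*n) → F, symForm F n (v ᵥ* M) (w ᵥ* M) = symForm F n v w

/-- Standard generator `s` : `e_1 ↦ f_1`, `f_1 ↦ -e_1`, fixing the other basis vectors.
(Row `i` is the image of the `i`-th basis vector.) -/
def sGen (F : Type) [Field F] (n : ℕ) : Matrix (Fin (2*n)) (Fin (2*n)) F :=
  Matrix.of fun i j =>
    if (i : ℕ) = 0 then (if (j : ℕ) = 2*n - 1 then 1 else 0)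
    else if (i : ℕ) = 2*n - 1 then (if (j : ℕ) = 0 then -1 else 0)
    else if j = i then 1 else 0

/-- Standard generator `t` : `e_1 ↦ e_1 + f_1`, fixing the other basis vectors. -/
def tGen (F : Type) [Field F] (n : ℕ) : Matrix (Fin (2*n)) (Fin (2*n)) F :=
  Matrix.of fun i j =>
    if (i : ℕ) = 0 then (if (j : ℕ) = 0 ∨ (j : ℕ) = 2*n - 1 then 1 else 0)
    else if j = i then 1 else 0

/-- Standard generator `δ` : `e_1 ↦ ω e_1`, `f_1 ↦ ω⁻¹ f_1`, fixing the other basis vectors. -/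
def dGen (F : Type) [Field F] (n : ℕ) (ω : Fˣ) : Matrix (Fin (2*n)) (Fin (2*n)) F :=
  Matrix.of fun i j =>
    if (i : ℕ) = 0 then (if j = i then (ω : F) else 0)
    else if (i : ℕ) = 2*n - 1 then (if j = i then ((ω⁻¹ : Fˣ) : F) else 0)
    else if j = i then 1 else 0

/-- Standard generator `u` : `e_1 ↔ e_2`, `f_1 ↔ f_2`, fixing the other basis vectors. -/
def uGen (F : Type) [Field F] (n : ℕ) : Matrix (Fin (2*n)) (Fin (2*n)) F :=
  Matrix.of fun i j =>
    if (i : ℕ) = 0 then (if (j : ℕ) = 1 then 1 else 0)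
    else if (i : ℕ) = 1 then (if (j : ℕ) = 0 then 1 else 0)
    else if (i : ℕ) = 2*n - 1 then (if (j : ℕ) = 2*n - 2 then 1 else 0)
    else if (i : ℕ) = 2*n - 2 then (if (j : ℕ) = 2*n - 1 then 1 else 0)
    else if j = i then 1 else 0

/-- Standard generator `v` : `e_i ↦ e_(i+1)`, `f_i ↦ f_(i+1)` (indices mod `n`),
fixing no basis vectors besides being the identity when `n = 1`. -/
def vGen (F : Type) [Field F] (n : ℕ) : Matrix (Fin (2*n)) (Fin (2*n)) F :=
  Matrix.of fun i j =>
    if (i : ℕ) < n then (if (j : ℕ) = ((i : ℕ) + 1) % n then 1 else 0)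
    else (if (j : ℕ) = (if (i : ℕ) = n then 2*n - 1 else (i : ℕ) - 1) then 1 else 0)

/-- Standard generator `x` : `f_1 ↦ f_1 + e_2`, `f_2 ↦ f_2 + e_1`, fixing the other
basis vectors. -/
def xGen (F : Type) [Field F] (n : ℕ) : Matrix (Fin (2*n)) (Fin (2*n)) F :=
  Matrix.of fun i j =>
    if (i : ℕ) = 2*n - 1 then (if (j : ℕ) = 2*n - 1 ∨ (j : ℕ) = 1 then 1 else 0)
    else if (i : ℕ) = 2*n - 2 then (if (j : ℕ) = 2*n - 2 ∨ (j : ℕ) = 0 then 1 else 0)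
    else if j = i then 1 else 0

/-- `z_α` : `e_1 ↦ e_1 - α e_2`, `f_2 ↦ α f_1 + f_2`, fixing the other basis vectors. -/
def zElt (F : Type) [Field F] (n : ℕ) (α : F) : Matrix (Fin (2*n)) (Fin (2*n)) F :=
  Matrix.of fun i j =>
    if (i : ℕ) = 0 then (if (j : ℕ) = 0 then 1 else if (j : ℕ) = 1 then -α else 0)
    else if (i : ℕ) = 2*n - 2 then
      (if (j : ℕ) = 2*n - 2 then 1 else if (j : ℕ) = 2*n - 1 then α else 0)
    else if j = i then 1 else 0

/-- The `t`-element `t(α_2, …, α_n, β_n, …, β_1)`.  The parameter tuple is encoded as a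
function `c : Fin (2n) → F` where `c j` is the parameter attached to the basis position
`j + 1` (1-based); thus `c 0` is irrelevant (ignored), for `1 ≤ j ≤ n - 1` the value `c j`
is `α_(j+1)`, for `n ≤ j ≤ 2n - 2` the value `c j` is `β_(2n-j)`, and `c (2n-1)` is the
last parameter `β_1`.  The matrix is that of the map
`e_1 ↦ e_1 + Σ_{i=2}^n α_i e_i + Σ_{i=1}^n β_i f_i`;
`e_i ↦ e_i + β_i f_1` and `f_i ↦ f_i - α_i f_1` for `2 ≤ i ≤ n`; `f_1 ↦ f_1`. -/
def tElt (F : Type) [Field F] (n : ℕ) (c : Fin (2*n) → F) :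
    Matrix (Fin (2*n)) (Fin (2*n)) F :=
  Matrix.of fun i j =>
    if (i : ℕ) = 0 then (if (j : ℕ) = 0 then 1 else c j)
    else if (i : ℕ) = 2*n - 1 then (if j = i then 1 else 0)
    else if j = i then 1
    else if (j : ℕ) = 2*n - 1 then
      (if (i : ℕ) < n then c ⟨2*n - 1 - (i : ℕ), by have := i.isLt; omega⟩
       else -(c ⟨2*n - 1 - (i : ℕ), by have := i.isLt; omega⟩))
    else 0

/-- `x_i(α) = t(0, …, 0, α, 0, …, 0)`, the `t`-element whose parameter at (1-based) basis
position `i + 1` is `α` (here `i : Fin (2n)` is the 0-based index of that basis position)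
and all other parameters (including the last parameter `β_1`) are `0`. -/
def xElt (F : Type) [Field F] (n : ℕ) (i : Fin (2*n)) (α : F) :
    Matrix (Fin (2*n)) (Fin (2*n)) F :=
  tElt F n (fun j => if j = i then α else 0)

section Aux
variable {F : Type} [Field F] {n : ℕ}

lemma aux_s (a l : Fin (2*n)) (ha : (a : ℕ) = 0) (hl : (l : ℕ) = 2*n - 1) (hal : a ≠ l) :
    sGen F n = 1 - single a a 1 - single l l 1 + single a l 1 - single l a 1 := by
  have h0 : ∀ i : Fin (2*n), (i : ℕ) = 0 ↔ a = i := fun i => by rw [Fin.ext_iff]; omega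
  have h1 : ∀ i : Fin (2*n), (i : ℕ) = 2*n - 1 ↔ l = i := fun i => by rw [Fin.ext_iff]; omega
  ext i j
  simp only [sGen, of_apply, Matrix.sub_apply, Matrix.add_apply, single_apply, Matrix.one_apply, h0, h1]
  by_cases c1 : a = i <;> by_cases c2 : l = i <;> by_cases c3 : a = j <;> by_cases c4 : l = j <;>
    simp_all [eq_comm]

lemma aux_t (a l : Fin (2*n)) (ha : (a : ℕ) = 0) (hl : (l : ℕ) = 2*n - 1) (hal : a ≠ l) :
    tGen F n = 1 + single a l 1 := by
  have h0 : ∀ i : Fin (2*n), (i : ℕ) = 0 ↔ a = i := fun i => by rw [Fin.ext_iff]; omega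
  have h1 : ∀ i : Fin (2*n), (i : ℕ) = 2*n - 1 ↔ l = i := fun i => by rw [Fin.ext_iff]; omega
  ext i j
  simp only [tGen, of_apply, Matrix.add_apply, single_apply, Matrix.one_apply, h0, h1]
  by_cases c1 : a = i <;> by_cases c3 : a = j <;> by_cases c4 : l = j <;>
    simp_all [eq_comm]

lemma aux_T (a l : Fin (2*n)) (ha : (a : ℕ) = 0) (hl : (l : ℕ) = 2*n - 1) (hal : a ≠ l) :
    (sGen F n)⁻¹ * tGen F n * sGen F n = 1 - single l a 1 := by
  have hs : sGen F n * (1 - single a a 1 - single l l 1 - single a l 1 + single l a 1) = 1 := by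
    rw [aux_s a l ha hl hal]
    simp [mul_add, add_mul, mul_sub, sub_mul, hal, hal.symm]
  have hd : IsUnit (sGen F n).det := (Matrix.isUnit_iff_isUnit_det _).1 (.of_mul_eq_one _ hs)
  have h2 : tGen F n * sGen F n = sGen F n * (1 - single l a 1) := by
    rw [aux_s a l ha hl hal, aux_t a l ha hl hal]
    simp [mul_add, add_mul, mul_sub, sub_mul, hal, hal.symm]
    abel
  rw [Matrix.mul_assoc, h2, nonsing_inv_mul_cancel_left _ _ hd]

lemma aux_J (hn : 0 < n) : formMatrix F n * formMatrix F n = -1 := by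
  ext i k
  rw [mul_apply, Finset.sum_eq_single ⟨2*n - 1 - i, by omega⟩]
  · simp only [formMatrix, of_apply, Matrix.neg_apply, Matrix.one_apply, Fin.ext_iff]
    have := i.isLt
    have := k.isLt
    by_cases h : (i : ℕ) = k
    · by_cases h' : (i : ℕ) < n
      · rw [if_pos (by omega), if_pos h', if_pos (by omega), if_neg (by omega), if_pos h]; simp
      · rw [if_pos (by omega), if_neg h', if_pos (by omega), if_pos (by omega), if_pos h]; simp
    · rw [if_neg h, if_neg (c := _ + (k : ℕ) = _) (by omega)]; simp
  · intro j _ hj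
    have : (i : ℕ) + j ≠ 2*n - 1 := fun h => hj (Fin.ext (by simp; omega))
    simp [formMatrix, this]
  · simp

lemma aux_g (g : Matrix (Fin (2*n)) (Fin (2*n)) F) (hg : IsSymplectic F n g) :
    g * formMatrix F n * gᵀ = formMatrix F n := by
  ext i j
  have := hg (Pi.single i 1) (Pi.single j 1)
  simp only [symForm] at this
  rw [← Matrix.mulVec_transpose, ← Matrix.mulVec_transpose] at this
  simp only [Matrix.mulVec_single_one, single_one_dotProduct] at this
  simp only [col_apply] at this
  rw [← this, Matrix.mul_assoc]
  simp only [mul_apply, dotProduct, mulVec, col_apply, transpose_apply]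

end Aux

/-- with `T₀ = s⁻¹ t s`, for `g ∈ Sp(2n, q)` the identity
`T₀ ^ (T₀ ^ g) = T₀` holds if and only if `g_{1, 2n} = 0`, i.e. iff the coefficient of
`f_1` in the image of `e_1` under `g` vanishes. -/
theorem membership_test_first_row
    (F : Type) [Field F] [Fintype F] (hq : Odd (Fintype.card F))
    (n : ℕ) (hn : 2 ≤ n)
    (g : Matrix (Fin (2*n)) (Fin (2*n)) F) (hg : IsSymplectic F n g) :
    ((g⁻¹ * ((sGen F n)⁻¹ * tGen F n * sGen F n) * g)⁻¹ *
        ((sGen F n)⁻¹ * tGen F n * sGen F n) *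
        (g⁻¹ * ((sGen F n)⁻¹ * tGen F n * sGen F n) * g)
      = (sGen F n)⁻¹ * tGen F n * sGen F n)
    ↔ g ⟨0, by omega⟩ ⟨2*n - 1, by omega⟩ = 0 := by
  obtain ⟨a, ha⟩ : ∃ a : Fin (2*n), a = ⟨0, by omega⟩ := ⟨_, rfl⟩
  obtain ⟨l, hl⟩ : ∃ l : Fin (2*n), l = ⟨2*n - 1, by omega⟩ := ⟨_, rfl⟩
  rw [← ha, ← hl]
  have hav : (a : ℕ) = 0 := by rw [ha]
  have hlv : (l : ℕ) = 2*n - 1 := by rw [hl]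
  have hal : a ≠ l := fun h => by
    have := congrArg Fin.val h
    omega
  rw [aux_T a l hav hlv hal]
  have hJ := aux_J (F := F) (n := n) (by omega)
  have h1 : g * (-(formMatrix F n * gᵀ * formMatrix F n)) = 1 := by
    rw [Matrix.mul_neg, ← Matrix.mul_assoc, ← Matrix.mul_assoc, aux_g g hg, hJ, neg_neg]
  have hinv : g⁻¹ = -(formMatrix F n * gᵀ * formMatrix F n) := inv_eq_right_inv h1
  have hgd : IsUnit g.det := (Matrix.isUnit_iff_isUnit_det _).1 (.of_mul_eq_one _ h1)
  have hent : g⁻¹ a l = - g a l := by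
    rw [hinv, Matrix.neg_apply, mul_apply, Finset.sum_eq_single a, mul_apply, Finset.sum_eq_single l]
    · simp [formMatrix, hav, hlv, show 0 < n by omega]
    · intro j _ hj
      have : (j : ℕ) ≠ 2*n - 1 := fun h => hj (Fin.ext (by omega))
      simp [formMatrix, hav, this]
    · simp
    · intro j _ hj
      have : (j : ℕ) + l ≠ 2*n - 1 := fun h => hj (Fin.ext (by omega))
      simp [formMatrix, this]
    · simp
  have hTd : (1 - single l a 1 : Matrix (Fin (2*n)) (Fin (2*n)) F) * (1 + single l a 1) = 1 := by
    simp [mul_add, sub_mul, hal]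
  have hTu : IsUnit (1 - single l a 1 : Matrix (Fin (2*n)) (Fin (2*n)) F) := .of_mul_eq_one _ hTd
  have hgu : IsUnit g := .of_mul_eq_one _ h1
  have hgiu : IsUnit g⁻¹ := .of_mul_eq_one _ (nonsing_inv_mul g hgd)
  have hX : IsUnit (g⁻¹ * (1 - single l a 1) * g).det :=
    (Matrix.isUnit_iff_isUnit_det _).1 ((hgiu.mul hTu).mul hgu)
  have hc : g⁻¹ * (1 - single l a 1) * g = 1 - g⁻¹ * single l a 1 * g := by
    rw [Matrix.mul_sub, Matrix.sub_mul, Matrix.mul_one, nonsing_inv_mul g hgd]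
  have hsand : ∀ M : Matrix (Fin (2*n)) (Fin (2*n)) F,
      single l a 1 * M * single l a 1 = M a l • single l a (1 : F) := by
    intro M
    rw [single_mul_mul_single]
    simp
  have e1 : single l a 1 * (g⁻¹ * single l a 1 * g) = (-g a l) • (single l a 1 * g) := by
    rw [← Matrix.mul_assoc, ← Matrix.mul_assoc, hsand, hent, smul_mul]
  have e2 : g⁻¹ * single l a 1 * g * single l a 1 = (g a l) • (g⁻¹ * single l a 1) := by
    rw [Matrix.mul_assoc, Matrix.mul_assoc, ← Matrix.mul_assoc (single l a 1), hsand, Matrix.mul_smul]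
  have key : ∀ X T : Matrix (Fin (2*n)) (Fin (2*n)) F, IsUnit X.det →
      (X⁻¹ * T * X = T ↔ T * X = X * T) := by
    intro X T h
    constructor
    · intro e
      calc T * X = X * (X⁻¹ * (T * X)) := (mul_nonsing_inv_cancel_left _ _ h).symm
        _ = X * T := by rw [← Matrix.mul_assoc X⁻¹, e]
    · intro e
      rw [Matrix.mul_assoc, e, nonsing_inv_mul_cancel_left _ _ h]
  rw [key _ _ hX, hc]
  have hcomm : ((1 - single l a 1) * (1 - g⁻¹ * single l a 1 * g)
      = (1 - g⁻¹ * single l a 1 * g) * (1 - single l a 1)) ↔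
      (-g a l) • (single l a 1 * g) = (g a l) • (g⁻¹ * single l a 1) := by
    rw [← e1, ← e2]
    generalize g⁻¹ * single l a 1 * g = Y
    generalize (single l a 1 : Matrix (Fin (2*n)) (Fin (2*n)) F) = N
    constructor
    · intro h
      have h3 : N * Y - Y * N = (1 - N) * (1 - Y) - (1 - Y) * (1 - N) := by noncomm_ring
      rw [h, sub_self] at h3
      exact sub_eq_zero.1 h3
    · intro h
      have h3 : (1 - N) * (1 - Y) - (1 - Y) * (1 - N) = N * Y - Y * N := by noncomm_ring
      rw [h, sub_self] at h3
      exact sub_eq_zero.1 h3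
  rw [hcomm]
  constructor
  · intro h
    have h4 := congrFun (congrFun h l) l
    simpa [hal, hal.symm] using h4
  · intro h
    simp [h]
end

section
/- Let g ∈ Sp(2n,q) with g_{1,2n} = 0, and set T_0 = t^s and b = (x^{(T_0^g)}·x^{−1})^s. Then b = t(γ_2,…,γ_{2n}), where γ_i = −g_{1,i}·g_{1,2n−1} for i = 2,…,2n−1 and γ_{2n} = −g_{1,2n−1}·(2g_{1,1} − g_{1,1}^2·g_{1,2n} − g_{1,2n−1}); here (γ_2,…,γ_{2n}) is the parameter tuple of a t-element, with γ_j attached to basis position j for 2 ≤ j ≤ 2n−1 and γ_{2n} being the last parameter β_1. -/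
open Matrix

section Aux
variable {F : Type} [Field F]

lemma aux_lt0 (n : ℕ) (hn : 2 ≤ n) : 0 < 2*n := by omega

lemma aux_lt1 (n : ℕ) (hn : 2 ≤ n) : 2*n - 1 < 2*n := by omega

/-- Basis vector. -/
def auxD (F : Type) [Field F] (n : ℕ) (k : ℕ) : Fin (2*n) → F := fun i => if (i : ℕ) = k then 1 else 0

lemma auxD_dot (n k : ℕ) (hk : k < 2*n) (v : Fin (2*n) → F) : auxD F n k ⬝ᵥ v = v ⟨k, hk⟩ := by
  unfold auxD dotProduct
  rw [Finset.sum_eq_single ⟨k, hk⟩]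
  · simp
  · intro b _ hb
    have : (b : ℕ) ≠ k := fun h => hb (Fin.ext h)
    simp [this]
  · simp

lemma dot_auxD (n k : ℕ) (hk : k < 2*n) (v : Fin (2*n) → F) : v ⬝ᵥ auxD F n k = v ⟨k, hk⟩ := by
  rw [dotProduct_comm, auxD_dot]

lemma auxJ_mulVec (n : ℕ) (w : Fin (2*n) → F) (i : Fin (2*n)) :
    (formMatrix F n *ᵥ w) i = (if (i : ℕ) < n then 1 else -1) * w ⟨2*n-1-i, by omega⟩ := by
  unfold Matrix.mulVec dotProduct
  rw [Finset.sum_eq_single ⟨2*n-1-i, by omega⟩]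
  · have : (i : ℕ) + (2*n-1-i) = 2*n-1 := by omega
    simp [formMatrix, this]
  · intro b _ hb
    have : ¬ (i : ℕ) + b = 2*n-1 := fun h => hb (Fin.ext (by simp; omega))
    simp [formMatrix, this]
  · simp

lemma auxJ_sq (n : ℕ) : formMatrix F n * formMatrix F n = -1 := by
  ext i j
  have := auxJ_mulVec n (fun k => formMatrix F n k j) i
  have h2 : (formMatrix F n * formMatrix F n) i j
    = (formMatrix F n *ᵥ (fun k => formMatrix F n k j)) i := rfl
  rw [h2, this]
  simp only [formMatrix, Matrix.of_apply, Matrix.neg_apply, Matrix.one_apply, Fin.ext_iff]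
  have := i.isLt
  have := j.isLt
  split_ifs <;> first | omega | simp

lemma auxG (n : ℕ) (g : Matrix (Fin (2*n)) (Fin (2*n)) F) (hg : IsSymplectic F n g) :
    g * formMatrix F n * gᵀ = formMatrix F n := by
  ext i j
  have := hg (Pi.single i 1) (Pi.single j 1)
  unfold symForm at this
  simp only [Matrix.single_one_vecMul, single_one_dotProduct, Matrix.mulVec_single_one] at this
  rw [Matrix.mul_assoc]
  simpa [Matrix.mul_apply, dotProduct, Matrix.mulVec] using this

lemma auxS_mul (n : ℕ) (hn : 2 ≤ n) (A : Matrix (Fin (2*n)) (Fin (2*n)) F) (i j : Fin (2*n)) :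
    (sGen F n * A) i j = if (i : ℕ) = 0 then A ⟨2*n-1, aux_lt1 n hn⟩ j
      else if (i : ℕ) = 2*n-1 then -A ⟨0, aux_lt0 n hn⟩ j else A i j := by
  rw [Matrix.mul_apply]
  split_ifs with h1 h2
  · rw [Finset.sum_eq_single ⟨2*n-1, aux_lt1 n hn⟩]
    · simp [sGen, h1]
    · intro b _ hb
      have : ¬ (b : ℕ) = 2*n-1 := fun h => hb (Fin.ext h)
      simp [sGen, h1, this]
    · simp
  · rw [Finset.sum_eq_single ⟨0, aux_lt0 n hn⟩]
    · simp only [sGen, Matrix.of_apply, if_neg h1, if_pos h2]; simp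
    · intro b _ hb
      have : ¬ (b : ℕ) = 0 := fun h => hb (Fin.ext h)
      simp only [sGen, Matrix.of_apply, if_neg h1, if_pos h2, if_neg this]; simp
    · simp
  · simp [sGen, h1, h2]

lemma aux_mulS (n : ℕ) (hn : 2 ≤ n) (A : Matrix (Fin (2*n)) (Fin (2*n)) F) (i j : Fin (2*n)) :
    (A * sGen F n) i j = if (j : ℕ) = 0 then -A i ⟨2*n-1, aux_lt1 n hn⟩
      else if (j : ℕ) = 2*n-1 then A i ⟨0, aux_lt0 n hn⟩ else A i j := by
  rw [Matrix.mul_apply]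
  split_ifs with h1 h2
  · rw [Finset.sum_eq_single ⟨2*n-1, aux_lt1 n hn⟩]
    · have : ¬ (2*n-1 = 0) := by omega
      simp [sGen, h1, this]
    · intro b _ hb
      have : ¬ (b : ℕ) = 2*n-1 := fun h => hb (Fin.ext h)
      simp only [sGen, Matrix.of_apply, Fin.ext_iff]
      split_ifs <;> first | omega | simp
    · simp
  · rw [Finset.sum_eq_single ⟨0, aux_lt0 n hn⟩]
    · simp [sGen, h2]
    · intro b _ hb
      have : ¬ (b : ℕ) = 0 := fun h => hb (Fin.ext h)
      simp only [sGen, Matrix.of_apply, Fin.ext_iff]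
      split_ifs <;> first | omega | simp
    · simp
  · rw [Finset.sum_eq_single j]
    · simp [sGen, h1, h2]
    · intro b _ hb
      have : ¬ (b : ℕ) = j := fun h => hb (Fin.ext h)
      simp only [sGen, Matrix.of_apply, Fin.ext_iff]
      split_ifs <;> first | omega | simp
    · simp

lemma auxS_unit (n : ℕ) (hn : 2 ≤ n) : IsUnit (sGen F n).det := by
  have h : sGen F n * (sGen F n)ᵀ = 1 := by
    ext i j
    rw [auxS_mul n hn]
    simp only [sGen, Matrix.transpose_apply, Matrix.of_apply, Matrix.one_apply, Fin.ext_iff]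
    have := i.isLt
    have := j.isLt
    split_ifs <;> first | omega | simp
  exact Matrix.isUnit_det_of_right_inverse h

lemma aux_conj (n : ℕ) (A B C : Matrix (Fin (2*n)) (Fin (2*n)) F) (hA : IsUnit A.det)
    (h : B * A = A * C) : A⁻¹ * B * A = C := by
  rw [Matrix.mul_assoc, h, Matrix.nonsing_inv_mul_cancel_left _ _ hA]

lemma auxT0 (n : ℕ) (hn : 2 ≤ n) : (sGen F n)⁻¹ * tGen F n * sGen F n
    = 1 - vecMulVec (auxD F n (2*n-1)) (auxD F n 0) := by
  apply aux_conj _ _ _ _ (auxS_unit n hn)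
  ext i j
  rw [auxS_mul n hn, aux_mulS n hn]
  simp only [tGen, auxD, Matrix.vecMulVec_apply, Matrix.of_apply, Matrix.one_apply, Matrix.sub_apply, Fin.ext_iff]
  have := i.isLt
  have := j.isLt
  split_ifs <;> first | omega | (simp; done) | simp at *

lemma auxTg (n : ℕ) (hn : 2 ≤ n) (g : Matrix (Fin (2*n)) (Fin (2*n)) F) (hg : IsSymplectic F n g) :
    g⁻¹ * (1 - vecMulVec (auxD F n (2*n-1)) (auxD F n 0)) * g
    = 1 + vecMulVec (formMatrix F n *ᵥ g ⟨0, aux_lt0 n hn⟩) (g ⟨0, aux_lt0 n hn⟩) := by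
  have hJ := auxG n g hg
  have hu : IsUnit g.det := by
    apply Matrix.isUnit_det_of_right_inverse (B := formMatrix F n * gᵀ * (-formMatrix F n))
    rw [← Matrix.mul_assoc, ← Matrix.mul_assoc, hJ, Matrix.mul_neg, auxJ_sq, neg_neg]
  apply aux_conj _ _ _ _ hu
  have h1 : auxD F n 0 ᵥ* g = g ⟨0, aux_lt0 n hn⟩ := by
    ext j
    exact auxD_dot n 0 (by omega) (fun k => g k j)
  have h2 : g *ᵥ (formMatrix F n *ᵥ g ⟨0, aux_lt0 n hn⟩) = - auxD F n (2*n-1) := by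
    have h3 : g ⟨0, aux_lt0 n hn⟩ = gᵀ *ᵥ auxD F n 0 := by rw [← h1, Matrix.mulVec_transpose]
    rw [h3, Matrix.mulVec_mulVec, Matrix.mulVec_mulVec, hJ]
    ext i
    rw [auxJ_mulVec]
    simp only [auxD, Pi.neg_apply]
    have := i.isLt
    split_ifs <;> first | omega | simp
  rw [Matrix.sub_mul, Matrix.mul_add, Matrix.vecMulVec_mul, Matrix.mul_vecMulVec, h1, h2]
  simp [Matrix.neg_vecMulVec, sub_eq_add_neg]

lemma aux_self (n : ℕ) (w : Fin (2*n) → F) : w ⬝ᵥ (formMatrix F n *ᵥ w) = 0 := by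
  unfold dotProduct
  apply Finset.sum_involution (fun (i : Fin (2*n)) _ => (⟨2*n-1-(i : ℕ), by omega⟩ : Fin (2*n)))
  · intro i _
    rw [auxJ_mulVec, auxJ_mulVec]
    have := i.isLt
    have h : (⟨2*n-1-(2*n-1-i), by omega⟩ : Fin (2*n)) = i := Fin.ext (by simp; omega)
    simp only [h]
    split_ifs <;> first | omega | ring
  · intro i _ _ h
    have := congrArg Fin.val h
    simp at this
    omega
  · intro i _
    apply Fin.ext
    have := i.isLt
    simp only
    omega
  · intro i _
    exact Finset.mem_univ _

lemma auxX (n : ℕ) (hn : 2 ≤ n) : xGen F n = 1 + vecMulVec (auxD F n (2*n-1)) (auxD F n 1)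
    + vecMulVec (auxD F n (2*n-2)) (auxD F n 0) := by
  ext i j
  simp only [xGen, auxD, Matrix.vecMulVec_apply, Matrix.of_apply, Matrix.one_apply, Matrix.add_apply, Fin.ext_iff]
  have := i.isLt
  have := j.isLt
  split_ifs <;> first | omega | simp

lemma auxD_dot_auxD (n k l : ℕ) (hk : k < 2*n) :
    auxD F n k ⬝ᵥ auxD F n l = if k = l then 1 else 0 := by
  rw [auxD_dot n k hk]; rfl

lemma auxX_unit (n : ℕ) (hn : 2 ≤ n) : IsUnit (xGen F n).det := by
  apply Matrix.isUnit_det_of_right_inverse (B := 1 - vecMulVec (auxD F n (2*n-1)) (auxD F n 1)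
    - vecMulVec (auxD F n (2*n-2)) (auxD F n 0))
  rw [auxX n hn]
  have e1 : 1 ≠ 2*n-1 := by omega
  have e2 : 1 ≠ 2*n-2 := by omega
  have e3 : 0 ≠ 2*n-1 := by omega
  have e4 : 0 ≠ 2*n-2 := by omega
  have p0 : 0 < 2*n := by omega
  have p1 : 1 < 2*n := by omega
  simp only [Matrix.mul_sub, Matrix.add_mul, Matrix.one_mul, Matrix.mul_one, Matrix.vecMulVec_mul_vecMulVec,
    auxD_dot_auxD n _ _ p0, auxD_dot_auxD n _ _ p1, e1, e2, e3, e4, if_false, zero_smul, Matrix.vecMulVec_zero]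
  abel

lemma aux_key (n : ℕ) (hn : 2 ≤ n) (a : F) (p w : Fin (2*n) → F) (hwp : w ⬝ᵥ p = 0)
    (hwl : w ⬝ᵥ auxD F n (2*n-1) = 0) (hwk : w ⬝ᵥ auxD F n (2*n-2) = a)
    (hp0 : auxD F n 0 ⬝ᵥ p = 0) (hp1 : auxD F n 1 ⬝ᵥ p = a) :
    xGen F n * (1 + vecMulVec p w) = (1 + vecMulVec p w) *
      ((1 + a • vecMulVec (auxD F n (2*n-1)) w - a^2 • vecMulVec (auxD F n (2*n-1)) (auxD F n 0)
        - a • vecMulVec p (auxD F n 0)) * xGen F n) := by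
  have p0 : 0 < 2*n := by omega
  have e3 : 0 ≠ 2*n-1 := by omega
  have e4 : 0 ≠ 2*n-2 := by omega
  rw [auxX n hn]
  have q3 := auxD_dot_auxD (F := F) n 0 (2*n-1) p0
  have q4 := auxD_dot_auxD (F := F) n 0 (2*n-2) p0
  rw [if_neg e3] at q3
  rw [if_neg e4] at q4
  generalize auxD F n (2*n-1) = dl at *
  generalize auxD F n (2*n-2) = dk at *
  generalize auxD F n 0 = d0 at *
  generalize auxD F n 1 = d1 at *
  simp only [Matrix.mul_sub, Matrix.mul_add, Matrix.sub_mul, Matrix.add_mul, Matrix.one_mul,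
    Matrix.mul_one, Matrix.smul_mul, Matrix.mul_smul,
    Matrix.vecMulVec_mul_vecMulVec, hwp, hwl, hwk, hp0, hp1, q3, q4,
    zero_smul, Matrix.vecMulVec_zero, Matrix.vecMulVec_smul, smul_zero, add_zero, sub_zero, zero_add]
  module

lemma aux_last (n : ℕ) (hn : 2 ≤ n) (w : Fin (2*n) → F) (a z : F)
    (h2n : w ⟨2*n-1, aux_lt1 n hn⟩ = 0) (hz : z = -a * (2 * w ⟨0, aux_lt0 n hn⟩ - a)) :
    (1 + a • vecMulVec (auxD F n (2*n-1)) w - a^2 • vecMulVec (auxD F n (2*n-1)) (auxD F n 0)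
        - a • vecMulVec (formMatrix F n *ᵥ w) (auxD F n 0)) * sGen F n
    = sGen F n * tElt F n (fun j => if (j : ℕ) = 0 then 0
          else if (j : ℕ) = 2*n - 1 then z else -(w j * a)) := by
  ext i j
  rw [auxS_mul n hn, aux_mulS n hn]
  simp only [tElt, auxD, Matrix.vecMulVec_apply, Matrix.of_apply, Matrix.one_apply,
    Matrix.add_apply, Matrix.sub_apply, Matrix.smul_apply, smul_eq_mul, auxJ_mulVec, Fin.ext_iff]
  obtain ⟨i, hi⟩ := i
  obtain ⟨j, hj⟩ := j
  have e0 : ¬ (2*n-1 = 0) := by omega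
  have e1 : ¬ (0 = 2*n-1) := by omega
  have e2 : ¬ (2*n-1 < n) := by omega
  have e3 : 0 < n := by omega
  have ci : i = 0 ∨ i = 2*n-1 ∨ (i ≠ 0 ∧ i ≠ 2*n-1 ∧ ¬ (2*n-1 = i) ∧ ¬ (0 = i) ∧ ¬ (2*n-1-i = 0) ∧ ¬ (2*n-1-i = 2*n-1)) := by omega
  have cj : j = 0 ∨ j = 2*n-1 ∨ (j ≠ 0 ∧ j ≠ 2*n-1 ∧ ¬ (2*n-1 = j) ∧ ¬ (0 = j)) := by omega
  rcases ci with rfl | rfl | ⟨i1, i2, i3, i4, i5, i6⟩ <;>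
  rcases cj with rfl | rfl | ⟨j1, j2, j3, j4⟩ <;>
  simp only [*, if_true, if_false, Nat.sub_self, Nat.sub_zero, ne_eq, not_true, not_false_eq_true] <;> (try ring1)
  all_goals (try split_ifs) <;> (first | omega | ring1)

end Aux

/-- if `g ∈ Sp(2n, q)` has `g_{1,2n} = 0`, then with `T₀ = t ^ s` and
`b = (x ^ (T₀ ^ g) · x⁻¹) ^ s` one has `b = t(γ_2, …, γ_{2n})` where
`γ_i = -g_{1,i} · g_{1,2n-1}` for `2 ≤ i ≤ 2n - 1` and
`γ_{2n} = -g_{1,2n-1} · (2 g_{1,1} - g_{1,1}² g_{1,2n} - g_{1,2n-1})`. -/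
theorem b_element_is_tElt
    (F : Type) [Field F] [Fintype F] (hq : Odd (Fintype.card F))
    (n : ℕ) (hn : 2 ≤ n)
    (g : Matrix (Fin (2*n)) (Fin (2*n)) F) (hg : IsSymplectic F n g)
    (h2n : g ⟨0, by omega⟩ ⟨2*n - 1, by omega⟩ = 0) :
    (sGen F n)⁻¹ *
        (((g⁻¹ * ((sGen F n)⁻¹ * tGen F n * sGen F n) * g)⁻¹ * xGen F n *
            (g⁻¹ * ((sGen F n)⁻¹ * tGen F n * sGen F n) * g)) * (xGen F n)⁻¹) *
        sGen F n
      = tElt F n (fun j => if (j : ℕ) = 0 then 0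
          else if (j : ℕ) = 2*n - 1 then
            -(g ⟨0, by omega⟩ ⟨2*n - 2, by omega⟩) *
              (2 * g ⟨0, by omega⟩ ⟨0, by omega⟩ -
                (g ⟨0, by omega⟩ ⟨0, by omega⟩) ^ 2 * g ⟨0, by omega⟩ ⟨2*n - 1, by omega⟩ -
                g ⟨0, by omega⟩ ⟨2*n - 2, by omega⟩)
          else -(g ⟨0, by omega⟩ j * g ⟨0, by omega⟩ ⟨2*n - 2, by omega⟩)) := by
  rw [auxT0 n hn, auxTg n hn g hg]
  set w := g ⟨0, by omega⟩ with hw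
  set p := formMatrix F n *ᵥ w with hp
  have hwp : w ⬝ᵥ p = 0 := aux_self n w
  have p0 : 0 < 2*n := by omega
  have p1 : 1 < 2*n := by omega
  have pl : 2*n-1 < 2*n := by omega
  have pk : 2*n-2 < 2*n := by omega
  have e1 : 1 ≠ 2*n-1 := by omega
  have e2 : 1 ≠ 2*n-2 := by omega
  have e3 : 0 ≠ 2*n-1 := by omega
  have e4 : 0 ≠ 2*n-2 := by omega
  set a := w ⟨2*n-2, pk⟩ with ha
  have hwl : w ⬝ᵥ auxD F n (2*n-1) = 0 := by rw [dot_auxD n _ pl]; exact h2n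
  have hwk : w ⬝ᵥ auxD F n (2*n-2) = a := by rw [dot_auxD n _ pk]
  have hp0 : auxD F n 0 ⬝ᵥ p = 0 := by
    rw [auxD_dot n _ p0, hp, auxJ_mulVec]
    have h3 : w ⟨2*n-1-0, by omega⟩ = 0 := h2n
    simp only [h3, mul_zero]
  have hp1 : auxD F n 1 ⬝ᵥ p = a := by
    rw [auxD_dot n _ p1, hp, auxJ_mulVec]
    have : 1 < n := by omega
    simp only [this, if_true, one_mul, ha]
    congr 1
  have hT : IsUnit (1 + vecMulVec p w).det := by
    apply Matrix.isUnit_det_of_right_inverse (B := 1 - vecMulVec p w)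
    simp only [Matrix.mul_sub, Matrix.add_mul, Matrix.one_mul, Matrix.mul_one,
      Matrix.vecMulVec_mul_vecMulVec, hwp, zero_smul, Matrix.vecMulVec_zero]
    abel
  have key : (1 + vecMulVec p w)⁻¹ * xGen F n * (1 + vecMulVec p w) =
      (1 + a • vecMulVec (auxD F n (2*n-1)) w - a^2 • vecMulVec (auxD F n (2*n-1)) (auxD F n 0)
        - a • vecMulVec p (auxD F n 0)) * xGen F n := by
    apply aux_conj _ _ _ _ hT
    exact aux_key n hn a p w hwp hwl hwk hp0 hp1
  rw [key, Matrix.mul_nonsing_inv_cancel_right _ _ (auxX_unit n hn)]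
  apply aux_conj _ _ _ _ (auxS_unit n hn)
  exact aux_last n hn w a _ h2n (by rw [h2n]; ring)
end

section
/- Let g ∈ Sp(2n,q) stabilize both subspaces ⟨e_1⟩ and ⟨f_1⟩ (i.e. g_{1,j} = 0 for all j ≠ 1 and g_{2n,j} = 0 for all j ≠ 2n). Then for every i with 2 ≤ i ≤ 2n−1 there exists c ∈ F such that x_i(1)^g = g^{−1}·x_i(1)·g = t(g_{i,2}/g_{1,1},…,g_{i,2n−1}/g_{1,1}, c), the t-element whose parameter at basis position j is g_{i,j}/g_{1,1} for 2 ≤ j ≤ 2n−1. -/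
open Matrix

theorem tElt_eq_aux (F : Type) [Field F] (n : ℕ) (hn : 2 ≤ n) (c : Fin (2*n) → F)
    (o L : Fin (2*n)) (ho : (o : ℕ) = 0) (hLv : (L : ℕ) = 2*n-1)
    (h0 : c o = 0) (hL : c L = 0) :
    tElt F n c = 1 + vecMulVec (Pi.single o 1) c
      + vecMulVec (formMatrix F n *ᵥ c) (Pi.single L 1) := by
  have hJ : ∀ a : Fin (2*n), (formMatrix F n *ᵥ c) a =
      (if (a : ℕ) < n then (1:F) else -1) * c ⟨2*n-1-a, by omega⟩ := by
    intro a
    rw [Matrix.mulVec, dotProduct, Finset.sum_eq_single ⟨2*n-1-a, by omega⟩]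
    · have : (a:ℕ) + (2*n-1-a) = 2*n-1 := by omega
      simp [formMatrix, this]
    · intro b _ hb
      have : ¬ ((a:ℕ) + b = 2*n-1) := by
        intro h; apply hb; ext; simp; omega
      simp [formMatrix, this]
    · simp
  ext a b
  simp only [Matrix.add_apply, vecMulVec_apply, hJ, tElt, Matrix.of_apply, Matrix.one_apply,
    Pi.single_apply, Fin.ext_iff, ho, hLv]
  have hb0 : (b : ℕ) = 0 → c b = 0 := by
    intro h; rw [← h0]; congr 1; ext; simp [h, ho, hLv]
  have hbL : (b : ℕ) = 2*n-1 → c b = 0 := by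
    intro h; rw [← hL]; congr 1; ext; simp [h, ho, hLv]
  have ha0 : (a : ℕ) = 0 → c ⟨2*n-1-a, by omega⟩ = 0 := by
    intro h; rw [← hL]; congr 1; ext; simp [h, ho, hLv]
  have haL : (a : ℕ) = 2*n-1 → c ⟨2*n-1-a, by omega⟩ = 0 := by
    intro h; rw [← h0]; congr 1; ext; simp [h, ho, hLv]
  generalize c b = x at hb0 hbL ⊢
  generalize c ⟨2*n-1-a, by omega⟩ = y at ha0 haL ⊢
  clear hJ h0 hL
  have hbl := b.isLt
  split_ifs <;> first
    | omega
    | grind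

theorem form_sq_aux (F : Type) [Field F] (n : ℕ) :
    formMatrix F n * formMatrix F n = -1 := by
  ext a b
  rw [Matrix.mul_apply, Finset.sum_eq_single ⟨2*n-1-a, by omega⟩]
  · have h1 : (a:ℕ) + (2*n-1-a) = 2*n-1 := by omega
    have h2 : (2*n-1-a + (b:ℕ) = 2*n-1) ↔ a = b := by rw [Fin.ext_iff]; omega
    have h3 : (2*n-1-a < n) ↔ ¬ ((a:ℕ) < n) := by omega
    simp only [formMatrix, Matrix.of_apply, h1, h2, h3, Matrix.neg_apply, Matrix.one_apply]
    split_ifs <;> simp_all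
  · intro d _ hd
    have : ¬ ((a:ℕ) + d = 2*n-1) := by
      intro h; apply hd; ext; simp; omega
    simp [formMatrix, this]
  · simp

theorem symp_aux (F : Type) [Field F] (n : ℕ) (g : Matrix (Fin (2*n)) (Fin (2*n)) F)
    (hg : IsSymplectic F n g) : g * formMatrix F n * gᵀ = formMatrix F n := by
  ext a b
  have := hg (Pi.single a 1) (Pi.single b 1)
  simp only [symForm, Matrix.single_one_vecMul, Matrix.mulVec_single_one,
    single_one_dotProduct] at this
  rw [Matrix.mul_assoc, Matrix.mul_apply]
  simpa [dotProduct, Matrix.mulVec, Matrix.mul_apply] using this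

/-- if `g ∈ Sp(2n, q)` stabilizes both `⟨e_1⟩` and `⟨f_1⟩` (i.e.
`g_{1,j} = 0` for `j ≠ 1` and `g_{2n,j} = 0` for `j ≠ 2n`), then for every basis position
`i` with `2 ≤ i ≤ 2n - 1` (0-based: `1 ≤ i ≤ 2n - 2`) there is `c ∈ F` with
`x_i(1) ^ g = g⁻¹ x_i(1) g = t(g_{i,2}/g_{1,1}, …, g_{i,2n-1}/g_{1,1}, c)`. -/
theorem xElt_conj_by_stabilizing_g
    (F : Type) [Field F] [Fintype F] (hq : Odd (Fintype.card F))
    (n : ℕ) (hn : 2 ≤ n)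
    (g : Matrix (Fin (2*n)) (Fin (2*n)) F) (hg : IsSymplectic F n g)
    (he1 : ∀ j : Fin (2*n), (j : ℕ) ≠ 0 → g ⟨0, by omega⟩ j = 0)
    (hf1 : ∀ j : Fin (2*n), (j : ℕ) ≠ 2*n - 1 → g ⟨2*n - 1, by omega⟩ j = 0)
    (i : Fin (2*n)) (hi1 : 1 ≤ (i : ℕ)) (hi2 : (i : ℕ) ≤ 2*n - 2) :
    ∃ c : F,
      g⁻¹ * xElt F n i 1 * g
        = tElt F n (fun j => if (j : ℕ) = 2*n - 1 then c
            else g i j / g ⟨0, by omega⟩ ⟨0, by omega⟩) := by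
  set o : Fin (2*n) := ⟨0, by omega⟩ with ho
  set L : Fin (2*n) := ⟨2*n-1, by omega⟩ with hLd
  have hS := symp_aux F n g hg
  have hJ2 := form_sq_aux F n
  have hinv : g * (formMatrix F n * gᵀ * (-formMatrix F n)) = 1 := by
    rw [← Matrix.mul_assoc, ← Matrix.mul_assoc, hS, Matrix.mul_neg, hJ2, neg_neg]
  have hdet : IsUnit g.det := by
    rw [← Matrix.isUnit_iff_isUnit_det]
    exact IsUnit.of_mul_eq_one _ hinv
  have hrow0 : Pi.single o 1 ᵥ* g = g o o • Pi.single o 1 := by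
    ext j
    by_cases hj : j = o
    · subst hj; simp
    · have : (j:ℕ) ≠ 0 := fun h => hj (Fin.ext h)
      simp [he1 j this, hj]
  have hrowL : Pi.single L 1 ᵥ* g = g L L • Pi.single L 1 := by
    ext j
    by_cases hj : j = L
    · subst hj; simp
    · have : (j:ℕ) ≠ 2*n-1 := fun h => hj (Fin.ext h)
      simp [hf1 j this, hj]
  -- pairing of any row with the first and last rows
  have hform : ∀ a b, symForm F n (Pi.single a 1 ᵥ* g) (Pi.single b 1 ᵥ* g)
      = formMatrix F n a b := by
    intro a b
    rw [hg]; simp [symForm]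
  have hpair0 : ∀ b, g o o * g b L = formMatrix F n o b := by
    intro b
    rw [← hform, hrow0, symForm, smul_dotProduct, single_one_dotProduct, Matrix.mulVec,
      dotProduct, Finset.sum_eq_single L]
    · simp [formMatrix, ho, hLd]
      intro h; omega
    · intro d _ hd
      have : ¬ ((d:ℕ) = 2*n-1) := fun h => hd (Fin.ext h)
      simp [formMatrix, ho, this]
    · simp
  have hpairL : ∀ a, g a o * g L L = formMatrix F n a L := by
    intro a
    rw [← hform, hrowL, symForm, Matrix.mulVec_smul, dotProduct_smul, Matrix.mulVec_single_one,
      dotProduct, Finset.sum_eq_single o]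
    · simp [formMatrix, ho, hLd, mul_comm]
      intro h; omega
    · intro d _ hd
      have : ¬ ((d:ℕ) = 0) := fun h => hd (Fin.ext h)
      simp [formMatrix, hLd, this]
    · simp
  have h00LL : g o o * g L L = 1 := by
    rw [hpair0]; simp [formMatrix, ho, hLd]; omega
  have hne : g o o ≠ 0 := left_ne_zero_of_mul_eq_one h00LL
  have hneL : g L L ≠ 0 := right_ne_zero_of_mul_eq_one h00LL
  have hcol : ∀ a, a ≠ o → g a o = 0 := by
    intro a ha
    have h := hpairL a
    have h1 : ¬ ((a:ℕ) = 0) := fun h => ha (Fin.ext h)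
    have h2 : ¬ ((a:ℕ) + (2*n-1) = 2*n-1) := by omega
    simp only [formMatrix, hLd, Matrix.of_apply, h2, if_false] at h
    exact (mul_eq_zero.mp h).resolve_right hneL
  have hiL : g i L = 0 := by
    have h := hpair0 i
    have h2 : ¬ (0 + (i:ℕ) = 2*n-1) := by omega
    simp only [formMatrix, ho, Matrix.of_apply, h2, if_false] at h
    exact (mul_eq_zero.mp h).resolve_left hne
  have hio : i ≠ o := by
    intro h; rw [h] at hi1; simp [ho] at hi1
  have hiL' : i ≠ L := by
    intro h; rw [h] at hi2; simp [hLd] at hi2; omega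
  refine ⟨0, ?_⟩
  have hc : (fun j : Fin (2*n) => if (j : ℕ) = 2*n - 1 then (0:F) else g i j / g o o)
      = (g o o)⁻¹ • (Pi.single i 1 ᵥ* g) := by
    ext j
    by_cases hj : j = L
    · subst hj; simp [hiL]
    · have : (j:ℕ) ≠ 2*n-1 := fun h => hj (Fin.ext h)
      simp [this, div_eq_inv_mul]
  have hx : (fun j : Fin (2*n) => if j = i then (1:F) else 0) = Pi.single i 1 := by
    ext j; simp [Pi.single_apply]
  have hgo : g *ᵥ Pi.single o 1 = g o o • Pi.single o 1 := by
    ext a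
    by_cases ha : a = o
    · subst ha; simp
    · simp [hcol a ha, ha]
  have hgJ : g *ᵥ (formMatrix F n *ᵥ (Pi.single i 1 ᵥ* g)) = formMatrix F n *ᵥ Pi.single i 1 := by
    rw [← Matrix.mulVec_transpose, Matrix.mulVec_mulVec, Matrix.mulVec_mulVec, hS]
  have key : xElt F n i 1 * g = g * tElt F n ((g o o)⁻¹ • (Pi.single i 1 ᵥ* g)) := by
    rw [xElt, hx, tElt_eq_aux F n hn _ o L rfl rfl, tElt_eq_aux F n hn _ o L rfl rfl]
    · change (1 + vecMulVec (Pi.single o 1) _ + vecMulVec _ (Pi.single L 1)) * g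
        = g * (1 + vecMulVec (Pi.single o 1) _ + vecMulVec _ (Pi.single L 1))
      rw [Matrix.add_mul, Matrix.add_mul, Matrix.mul_add, Matrix.mul_add, Matrix.one_mul,
        Matrix.mul_one, Matrix.vecMulVec_mul, Matrix.vecMulVec_mul, Matrix.mul_vecMulVec,
        Matrix.mul_vecMulVec, hgo, hrowL, Matrix.mulVec_smul, Matrix.mulVec_smul, hgJ]
      have : (g o o)⁻¹ = g L L := inv_eq_of_mul_eq_one_right h00LL
      rw [Matrix.smul_vecMulVec, Matrix.vecMulVec_smul, Matrix.vecMulVec_smul,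
        Matrix.smul_vecMulVec, smul_smul, mul_inv_cancel₀ hne, one_smul, this]
    · change ((g o o)⁻¹ • (Pi.single i 1 ᵥ* g)) o = 0
      simp [hcol i hio]
    · change ((g o o)⁻¹ • (Pi.single i 1 ᵥ* g)) L = 0
      simp [hiL]
    · exact Pi.single_eq_of_ne hio.symm _
    · exact Pi.single_eq_of_ne hiL'.symm _
  rw [Matrix.mul_assoc, hc, key, ← Matrix.mul_assoc, Matrix.nonsing_inv_mul _ hdet, Matrix.one_mul]
end

section
/- The six standard generators generate the symplectic group: the subgroup of GL(2n,q) generated by {s, t, δ, u, v, x} equals Sp(2n,q). -/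
open Matrix

open Matrix

section Aux

variable {F : Type} [Field F] {n : ℕ}

def sgnI (F : Type) [Field F] (n : ℕ) (i : Fin (2*n)) : F := if (i : ℕ) < n then 1 else -1

lemma symForm_eq_sum (v w : Fin (2*n) → F) :
    symForm F n v w = ∑ i, v i * (sgnI F n i * w (Fin.rev i)) := by
  unfold symForm
  simp only [dotProduct, mulVec]
  refine Finset.sum_congr rfl fun i _ => ?_
  congr 1
  rw [Finset.sum_eq_single (Fin.rev i)]
  · have h := i.isLt
    have : (i : ℕ) + (Fin.rev i : ℕ) = 2*n - 1 := by rw [Fin.val_rev]; omega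
    simp only [formMatrix, of_apply, this, if_true, sgnI]
  · intro b _ hb
    have : ¬ ((i : ℕ) + (b : ℕ) = 2*n - 1) := by
      intro h
      apply hb
      apply Fin.ext
      rw [Fin.val_rev]
      have := i.isLt
      omega
    simp [formMatrix, this]
  · simp

lemma sgnI_rev (i : Fin (2*n)) : sgnI F n (Fin.rev i) = - sgnI F n i := by
  have := i.isLt
  unfold sgnI
  rw [Fin.val_rev]
  split_ifs <;> first | omega | simp

lemma symForm_skew (v w : Fin (2*n) → F) : symForm F n v w = - symForm F n w v := by
  rw [symForm_eq_sum, symForm_eq_sum, ← Finset.sum_neg_distrib]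
  rw [← Equiv.sum_comp Fin.revPerm]
  refine Finset.sum_congr rfl fun i _ => ?_
  simp only [Fin.revPerm_apply, Fin.rev_rev, sgnI_rev]
  ring

lemma symForm_self (h2 : (2 : F) ≠ 0) (v : Fin (2*n) → F) : symForm F n v v = 0 := by
  have h := symForm_skew v v
  have : (2 : F) * symForm F n v v = 0 := by linear_combination h
  exact (mul_eq_zero.mp this).resolve_left h2

lemma symForm_add_left (u v w : Fin (2*n) → F) :
    symForm F n (u + v) w = symForm F n u w + symForm F n v w := by
  simp [symForm, add_dotProduct]
lemma symForm_sub_left (u v w : Fin (2*n) → F) :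
    symForm F n (u - v) w = symForm F n u w - symForm F n v w := by
  simp [symForm, sub_dotProduct]
lemma symForm_smul_left (c : F) (v w : Fin (2*n) → F) :
    symForm F n (c • v) w = c * symForm F n v w := by
  simp [symForm, smul_dotProduct]
lemma symForm_add_right (u v w : Fin (2*n) → F) :
    symForm F n u (v + w) = symForm F n u v + symForm F n u w := by
  simp [symForm, mulVec_add, dotProduct_add]
lemma symForm_sub_right (u v w : Fin (2*n) → F) :
    symForm F n u (v - w) = symForm F n u v - symForm F n u w := by
  simp [symForm, mulVec_sub, dotProduct_sub]
lemma symForm_smul_right (c : F) (v w : Fin (2*n) → F) :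
    symForm F n v (c • w) = c * symForm F n v w := by
  simp [symForm, mulVec_smul, dotProduct_smul]
lemma symForm_neg_right (v w : Fin (2*n) → F) :
    symForm F n v (-w) = - symForm F n v w := by
  simp [symForm, mulVec_neg, dotProduct_neg]
lemma symForm_neg_left (v w : Fin (2*n) → F) :
    symForm F n (-v) w = - symForm F n v w := by
  simp [symForm, neg_dotProduct]

lemma symForm_single (i j : Fin (2*n)) :
    symForm F n (Pi.single i 1) (Pi.single j 1) = formMatrix F n i j := by
  simp [symForm]

lemma symForm_single_left (i : Fin (2*n)) (w : Fin (2*n) → F) :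
    symForm F n (Pi.single i 1) w = sgnI F n i * w (Fin.rev i) := by
  rw [symForm_eq_sum, Finset.sum_eq_single i]
  · simp
  · intro b _ hb; simp [hb]
  · simp

lemma sgnI_ne (i : Fin (2*n)) : sgnI F n i ≠ 0 := by
  unfold sgnI; split_ifs <;> simp

lemma symForm_nondeg (w : Fin (2*n) → F) (hw : w ≠ 0) : ∃ z, symForm F n z w ≠ 0 := by
  obtain ⟨j, hj⟩ := Function.ne_iff.mp hw
  refine ⟨Pi.single (Fin.rev j) 1, ?_⟩
  rw [symForm_single_left, Fin.rev_rev]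
  exact mul_ne_zero (sgnI_ne _) hj

/-- transvection matrix -/
def TM (v : Fin (2*n) → F) (a : F) : Matrix (Fin (2*n)) (Fin (2*n)) F :=
  1 + a • vecMulVec (formMatrix F n *ᵥ v) v

lemma vecMul_TM (v w : Fin (2*n) → F) (a : F) :
    w ᵥ* TM v a = w + (a * symForm F n w v) • v := by
  simp only [TM, vecMul_add, vecMul_one, vecMul_smul, vecMul_vecMulVec, symForm, smul_smul]

lemma mat_ext {M N : Matrix (Fin (2*n)) (Fin (2*n)) F} (h : ∀ w, w ᵥ* M = w ᵥ* N) : M = N := by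
  ext i j
  have := congrFun (h (Pi.single i 1)) j
  simpa using this

lemma TM_mul (h2 : (2 : F) ≠ 0) (v : Fin (2*n) → F) (a b : F) :
    TM v a * TM v b = TM v (a + b) := by
  apply mat_ext
  intro w
  rw [← vecMul_vecMul, vecMul_TM, vecMul_TM, vecMul_TM, symForm_add_left, symForm_smul_left,
    symForm_self h2]
  module

lemma TM_zero (v : Fin (2*n) → F) : TM v 0 = 1 := by simp [TM]

def TU (h2 : (2 : F) ≠ 0) (v : Fin (2*n) → F) (a : F) : (Matrix (Fin (2*n)) (Fin (2*n)) F)ˣ where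
  val := TM v a
  inv := TM v (-a)
  val_inv := by rw [TM_mul h2, add_neg_cancel, TM_zero]
  inv_val := by rw [TM_mul h2, neg_add_cancel, TM_zero]

lemma TM_symp (h2 : (2 : F) ≠ 0) (v : Fin (2*n) → F) (a : F) : IsSymplectic F n (TM v a) := by
  intro x y
  simp only [vecMul_TM, symForm_add_left, symForm_add_right, symForm_smul_left,
    symForm_smul_right, symForm_self h2]
  rw [symForm_skew v y]
  ring

lemma symp_mul {M N : Matrix (Fin (2*n)) (Fin (2*n)) F} (hM : IsSymplectic F n M)
    (hN : IsSymplectic F n N) : IsSymplectic F n (M * N) := by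
  intro v w
  rw [← vecMul_vecMul, ← vecMul_vecMul, hN, hM]

lemma vecMul_inv_cancel (g : (Matrix (Fin (2*n)) (Fin (2*n)) F)ˣ) (w : Fin (2*n) → F) :
    (w ᵥ* (g⁻¹).val) ᵥ* g.val = w := by
  rw [vecMul_vecMul, Units.inv_mul, vecMul_one]

lemma symp_inv {M : (Matrix (Fin (2*n)) (Fin (2*n)) F)ˣ} (hM : IsSymplectic F n M.val) :
    IsSymplectic F n (M⁻¹).val := by
  intro v w
  rw [← hM, vecMul_inv_cancel, vecMul_inv_cancel]

def fixS (M : Matrix (Fin (2*n)) (Fin (2*n)) F) : Submodule F (Fin (2*n) → F) where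
  carrier := {w | w ᵥ* M = w}
  add_mem' := by
    intro a b ha hb
    simp only [Set.mem_ofPred_eq] at *
    rw [add_vecMul, ha, hb]
  zero_mem' := by simp
  smul_mem' := by
    intro c a ha
    simp only [Set.mem_ofPred_eq] at *
    rw [smul_vecMul, ha]

lemma mem_fixS (M : Matrix (Fin (2*n)) (Fin (2*n)) F) (w : Fin (2*n) → F) :
    w ∈ fixS M ↔ w ᵥ* M = w := Iff.rfl

/-- fixed vectors are orthogonal to `v M - v` -/
lemma fix_orth {M : Matrix (Fin (2*n)) (Fin (2*n)) F} (hM : IsSymplectic F n M)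
    {w : Fin (2*n) → F} (hw : w ∈ fixS M) (v : Fin (2*n) → F) :
    symForm F n w (v ᵥ* M - v) = 0 := by
  rw [mem_fixS] at hw
  have := hM w v
  rw [hw] at this
  rw [symForm_sub_right, this, sub_self]

lemma fix_le (M : Matrix (Fin (2*n)) (Fin (2*n)) F) (hM : IsSymplectic F n M)
    (v : Fin (2*n) → F) (a : F) : fixS M ≤ fixS (M * TM (v ᵥ* M - v) a) := by
  intro w hw
  have h := fix_orth hM hw v
  rw [mem_fixS] at hw ⊢
  rw [← vecMul_vecMul, hw, vecMul_TM, h]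
  simp

lemma fix_grow (h2 : (2 : F) ≠ 0) (M : Matrix (Fin (2*n)) (Fin (2*n)) F)
    (hM : IsSymplectic F n M)
    (z : Fin (2*n) → F) (hz : symForm F n z (z ᵥ* M) ≠ 0) :
    ∃ a : F, fixS M < fixS (M * TM (z ᵥ* M - z) a) := by
  refine ⟨-(symForm F n z (z ᵥ* M))⁻¹, lt_of_le_of_ne (fix_le M hM z _) ?_⟩
  intro h
  have hmem : z ∈ fixS (M * TM (z ᵥ* M - z) (-(symForm F n z (z ᵥ* M))⁻¹)) := by
    rw [mem_fixS, ← vecMul_vecMul, vecMul_TM]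
    have : symForm F n (z ᵥ* M) (z ᵥ* M - z) = symForm F n z (z ᵥ* M) := by
      rw [symForm_sub_right, symForm_self h2, symForm_skew (z ᵥ* M) z]; ring
    rw [this, neg_mul, inv_mul_cancel₀ hz]
    module
  rw [← h, mem_fixS] at hmem
  rw [hmem, symForm_self h2] at hz
  exact hz rfl

theorem symp_mem_of_transvections (h2 : (2 : F) ≠ 0)
    (H : Subgroup (Matrix (Fin (2*n)) (Fin (2*n)) F)ˣ)
    (hT : ∀ v a, TU h2 v a ∈ H) :
    ∀ U : Submodule F (Fin (2*n) → F), ∀ y : (Matrix (Fin (2*n)) (Fin (2*n)) F)ˣ,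
      fixS y.val = U → IsSymplectic F n y.val → y ∈ H := by
  intro U
  induction U using WellFoundedGT.induction with
  | ind U ih =>
  intro y hU hy
  -- case A
  have key : ∀ (y' : (Matrix (Fin (2*n)) (Fin (2*n)) F)ˣ), IsSymplectic F n y'.val →
      U ≤ fixS y'.val → (∃ z, symForm F n z (z ᵥ* y'.val) ≠ 0) → y' ∈ H := by
    rintro y' hy' hle ⟨z, hz⟩
    obtain ⟨a, ha⟩ := fix_grow h2 y'.val hy' z hz
    have := ih _ (lt_of_le_of_lt hle ha) (y' * TU h2 (z ᵥ* y'.val - z) a) rfl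
      (symp_mul hy' (TM_symp h2 _ _))
    exact (Subgroup.mul_mem_cancel_right H (hT _ _)).mp this
  by_cases hex : ∃ z, symForm F n z (z ᵥ* y.val) ≠ 0
  · exact key y hy hU.ge hex
  push Not at hex
  by_cases hone : ∀ v, v ᵥ* y.val = v
  · have : y = 1 := by
      apply Units.ext
      apply mat_ext
      intro w
      rw [hone, Units.val_one, vecMul_one]
    rw [this]; exact H.one_mem
  push Not at hone
  obtain ⟨v, hv⟩ := hone
  have hw : v ᵥ* y.val - v ≠ 0 := sub_ne_zero.mpr hv
  obtain ⟨z, hz⟩ := symForm_nondeg _ hw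
  have := key (y * TU h2 (v ᵥ* y.val - v) 1) (symp_mul hy (TM_symp h2 _ _))
    (hU ▸ fix_le y.val hy v 1) ⟨z, ?_⟩
  · exact (Subgroup.mul_mem_cancel_right H (hT _ _)).mp this
  · have e1 : symForm F n (z ᵥ* y.val) (v ᵥ* y.val - v) = - symForm F n z (v ᵥ* y.val - v) := by
      rw [symForm_sub_right, symForm_sub_right, hy]
      have h := hex (z + v)
      rw [add_vecMul, symForm_add_left, symForm_add_right, symForm_add_right, hex, hex] at h
      rw [symForm_skew (z ᵥ* y.val) v]
      linear_combination h
    have : (y * TU h2 (v ᵥ* y.val - v) 1).val = y.val * TM (v ᵥ* y.val - v) 1 := rfl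
    rw [this, ← vecMul_vecMul, vecMul_TM, symForm_add_right, hex, symForm_smul_right, e1]
    simpa using hz

/-! ### the set of good vectors -/

/-- Swap lemma. -/
lemma swap_lemma (S : Set (Fin (2*n) → F))
    (hS : ∀ v w, v ∈ S → w ∈ S → symForm F n v w ≠ 0 → v + w ∈ S)
    (h2 : (2 : F) ≠ 0)
    (W : Submodule F (Fin (2*n) → F)) (hW : ∀ w ∈ W, w ∈ S)
    (hnd : ∀ w ∈ W, w ≠ 0 → ∃ z ∈ W, symForm F n w z ≠ 0)
    (u : Fin (2*n) → F) (hu : ∀ w ∈ W, symForm F n u w = 0)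
    (x y : Fin (2*n) → F) (hx : x ∈ W) (hy : y ∈ W) (hx0 : x ≠ 0) (hy0 : y ≠ 0)
    (hux : u + x ∈ S) : u + y ∈ S := by
  have step : ∀ x ∈ W, ∀ z ∈ W, symForm F n x z ≠ 0 → u + x ∈ S → u + z ∈ S := by
    intro x hx z hz hxz hux
    have := hS (u + x) (z - x) hux (hW _ (W.sub_mem hz hx)) (by
      rw [symForm_add_left, hu _ (W.sub_mem hz hx), symForm_sub_right, symForm_self h2]
      simpa using hxz)
    convert this using 1
    abel
  have hz : ∃ z ∈ W, symForm F n x z ≠ 0 ∧ symForm F n y z ≠ 0 := by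
    obtain ⟨a, ha, hxa⟩ := hnd x hx hx0
    obtain ⟨b, hb, hyb⟩ := hnd y hy hy0
    by_cases h1 : symForm F n y a = 0
    · by_cases h3 : symForm F n x b = 0
      · refine ⟨a + b, W.add_mem ha hb, ?_, ?_⟩
        · rw [symForm_add_right, h3]; simpa using hxa
        · rw [symForm_add_right, h1]; simpa using hyb
      · exact ⟨b, hb, h3, hyb⟩
    · exact ⟨a, ha, hxa, h1⟩
  obtain ⟨z, hz, h1, h3⟩ := hz
  refine step z hz y hy ?_ (step x hx z hz h1 hux)
  rw [symForm_skew]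
  exact neg_ne_zero.mpr h3

lemma join_lemma (S : Set (Fin (2*n) → F))
    (hS : ∀ v w, v ∈ S → w ∈ S → symForm F n v w ≠ 0 → v + w ∈ S)
    (h2 : (2 : F) ≠ 0)
    (W P : Submodule F (Fin (2*n) → F)) (hW : ∀ w ∈ W, w ∈ S) (hP : ∀ w ∈ P, w ∈ S)
    (hndW : ∀ w ∈ W, w ≠ 0 → ∃ z ∈ W, symForm F n w z ≠ 0)
    (hndP : ∀ w ∈ P, w ≠ 0 → ∃ z ∈ P, symForm F n w z ≠ 0)
    (horth : ∀ w ∈ W, ∀ p ∈ P, symForm F n w p = 0)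
    (hlink : ∃ w ∈ W, ∃ p ∈ P, w ≠ 0 ∧ p ≠ 0 ∧ w + p ∈ S) :
    (∀ w ∈ W ⊔ P, w ∈ S) ∧
    (∀ w ∈ W ⊔ P, w ≠ 0 → ∃ z ∈ W ⊔ P, symForm F n w z ≠ 0) := by
  have horth' : ∀ p ∈ P, ∀ w ∈ W, symForm F n p w = 0 := by
    intro p hp w hw
    rw [symForm_skew, horth w hw p hp, neg_zero]
  constructor
  · intro x hx
    obtain ⟨w, hw, p, hp, rfl⟩ := Submodule.mem_sup.mp hx
    obtain ⟨w0, hw0, p0, hp0, hw00, hp00, h0⟩ := hlink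
    by_cases hwz : w = 0
    · rw [hwz, zero_add]; exact hP p hp
    by_cases hpz : p = 0
    · rw [hpz, add_zero]; exact hW w hw
    have h1 : w0 + p ∈ S :=
      swap_lemma S hS h2 P hP hndP w0 (horth w0 hw0) p0 p hp0 hp hp00 hpz h0
    rw [add_comm] at h1 ⊢
    exact swap_lemma S hS h2 W hW hndW p (horth' p hp) w0 w hw0 hw hw00 hwz h1
  · intro x hx hx0
    obtain ⟨w, hw, p, hp, rfl⟩ := Submodule.mem_sup.mp hx
    by_cases hwz : w = 0
    · have hpz : p ≠ 0 := by rintro rfl; exact hx0 (by rw [hwz, add_zero])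
      obtain ⟨z, hz, hzz⟩ := hndP p hp hpz
      refine ⟨z, Submodule.mem_sup_right hz, ?_⟩
      rw [hwz, zero_add]; exact hzz
    · obtain ⟨z, hz, hzz⟩ := hndW w hw hwz
      refine ⟨z, Submodule.mem_sup_left hz, ?_⟩
      rw [symForm_add_left, horth' p hp z hz, add_zero]
      exact hzz

def eV (F : Type) [Field F] (n : ℕ) (i : ℕ) (hi : i < n) : Fin (2*n) → F :=
  Pi.single ⟨i, by omega⟩ 1
def fV (F : Type) [Field F] (n : ℕ) (i : ℕ) (hi : i < n) : Fin (2*n) → F :=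
  Pi.single ⟨2*n-1-i, by omega⟩ 1

lemma form_ef (i j : ℕ) (hi : i < n) (hj : j < n) :
    symForm F n (eV F n i hi) (fV F n j hj) = if i = j then 1 else 0 := by
  rw [eV, fV, symForm_single]
  simp only [formMatrix, of_apply]
  split_ifs <;> first | rfl | omega
lemma form_fe (i j : ℕ) (hi : i < n) (hj : j < n) :
    symForm F n (fV F n i hi) (eV F n j hj) = if i = j then -1 else 0 := by
  rw [eV, fV, symForm_single]
  simp only [formMatrix, of_apply]
  split_ifs <;> first | rfl | omega
lemma form_ee (i j : ℕ) (hi : i < n) (hj : j < n) :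
    symForm F n (eV F n i hi) (eV F n j hj) = 0 := by
  rw [eV, eV, symForm_single]
  simp only [formMatrix, of_apply]
  split_ifs <;> first | rfl | omega
lemma form_ff (i j : ℕ) (hi : i < n) (hj : j < n) :
    symForm F n (fV F n i hi) (fV F n j hj) = 0 := by
  rw [fV, fV, symForm_single]
  simp only [formMatrix, of_apply]
  split_ifs <;> first | rfl | omega

lemma all_good (h2 : (2 : F) ≠ 0) (hn : 2 ≤ n) (S : Set (Fin (2*n) → F))
    (hS : ∀ v w, v ∈ S → w ∈ S → symForm F n v w ≠ 0 → v + w ∈ S)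
    (hsm : ∀ (c : F) v, v ∈ S → c • v ∈ S)
    (he : ∀ i hi, eV F n i hi ∈ S) (hf : ∀ i hi, fV F n i hi ∈ S)
    (hl : ∀ i (hi : i + 1 < n), fV F n i (by omega) + eV F n (i+1) hi ∈ S) :
    ∀ v, v ∈ S := by
  have plane : ∀ i (hi : i < n),
      (∀ w ∈ Submodule.span F {eV F n i hi, fV F n i hi}, w ∈ S) ∧
      (∀ w ∈ Submodule.span F {eV F n i hi, fV F n i hi}, w ≠ 0 →
        ∃ z ∈ Submodule.span F {eV F n i hi, fV F n i hi}, symForm F n w z ≠ 0) := by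
    intro i hi
    constructor
    · intro w hw
      obtain ⟨a, b, rfl⟩ := Submodule.mem_span_pair.mp hw
      by_cases ha : a = 0
      · rw [ha, zero_smul, zero_add]; exact hsm _ _ (hf i hi)
      by_cases hb : b = 0
      · rw [hb, zero_smul, add_zero]; exact hsm _ _ (he i hi)
      apply hS _ _ (hsm _ _ (he i hi)) (hsm _ _ (hf i hi))
      rw [symForm_smul_left, symForm_smul_right, form_ef]
      simp [ha, hb]
    · intro w hw hw0
      obtain ⟨a, b, rfl⟩ := Submodule.mem_span_pair.mp hw
      by_cases ha : a = 0
      · refine ⟨eV F n i hi, Submodule.subset_span (by simp), ?_⟩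
        rw [symForm_add_left, symForm_smul_left, symForm_smul_left, form_ee, form_fe]
        have hb : b ≠ 0 := by rintro rfl; apply hw0; simp [ha]
        simpa using hb
      · refine ⟨fV F n i hi, Submodule.subset_span (by simp), ?_⟩
        rw [symForm_add_left, symForm_smul_left, symForm_smul_left, form_ef, form_ff]
        simpa using ha
  have main : ∀ m, m + 1 ≤ n → ∃ W : Submodule F (Fin (2*n) → F),
      (∀ w ∈ W, w ∈ S) ∧ (∀ w ∈ W, w ≠ 0 → ∃ z ∈ W, symForm F n w z ≠ 0) ∧
      (∀ i hi, i ≤ m → eV F n i hi ∈ W ∧ fV F n i hi ∈ W) ∧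
      (∀ i hi, m < i → ∀ w ∈ W,
        symForm F n w (eV F n i hi) = 0 ∧ symForm F n w (fV F n i hi) = 0) := by
    intro m
    induction m with
    | zero =>
      intro hm
      refine ⟨_, (plane 0 (by omega)).1, (plane 0 (by omega)).2, ?_, ?_⟩
      · intro i hi h0
        obtain rfl : i = 0 := by omega
        exact ⟨Submodule.subset_span (by simp), Submodule.subset_span (by simp)⟩
      · intro i hi h0 w hw
        obtain ⟨a, b, rfl⟩ := Submodule.mem_span_pair.mp hw
        have : ¬ (0 = i) := by omega
        simp [symForm_add_left, symForm_smul_left, form_ee, form_ef, form_ff, form_fe, this]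
    | succ m ih =>
      intro hm
      obtain ⟨W, hW, hnd, hin, horth⟩ := ih (by omega)
      have hm1 : m + 1 < n := by omega
      have hj := join_lemma S hS h2 W _ hW (plane (m+1) hm1).1 hnd (plane (m+1) hm1).2 (by
          intro w hw p hp
          obtain ⟨a, b, rfl⟩ := Submodule.mem_span_pair.mp hp
          obtain ⟨h1, h3⟩ := horth (m+1) hm1 (by omega) w hw
          simp [symForm_add_right, symForm_smul_right, h1, h3])
        ⟨fV F n m (by omega), (hin m (by omega) le_rfl).2, eV F n (m+1) hm1,
          Submodule.subset_span (by simp), by simp [fV], by simp [eV], hl m hm1⟩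
      refine ⟨_, hj.1, hj.2, ?_, ?_⟩
      · intro i hi him
        rcases Nat.lt_or_ge m i with h | h
        · obtain rfl : i = m + 1 := by omega
          exact ⟨Submodule.mem_sup_right (Submodule.subset_span (by simp)),
            Submodule.mem_sup_right (Submodule.subset_span (by simp))⟩
        · exact ⟨Submodule.mem_sup_left (hin i hi h).1, Submodule.mem_sup_left (hin i hi h).2⟩
      · intro i hi him x hx
        obtain ⟨w, hw, p, hp, rfl⟩ := Submodule.mem_sup.mp hx
        obtain ⟨a, b, rfl⟩ := Submodule.mem_span_pair.mp hp
        obtain ⟨h1, h3⟩ := horth i hi (by omega) w hw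
        have : ¬ (m + 1 = i) := by omega
        simp [symForm_add_left, symForm_smul_left, form_ee, form_ef, form_ff, form_fe, this,
          h1, h3]
  obtain ⟨W, hW, -, hin, -⟩ := main (n-1) (by omega)
  intro v
  apply hW
  rw [pi_eq_sum_univ' v]
  refine W.sum_mem fun i _ => W.smul_mem _ ?_
  have hi := i.isLt
  rcases Nat.lt_or_ge (i : ℕ) n with h | h
  · have := (hin i h (by omega)).1
    convert this using 1
    ext j; simp [eV, Pi.single_apply, eq_comm]
  · have := (hin (2*n-1-i) (by omega) (by omega)).2
    convert this using 1
    ext j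
    have : 2*n-1-(2*n-1-(i:ℕ)) = i := by omega
    simp [fV, Pi.single_apply, eq_comm, this]

/-! ### the generators are symplectic -/

lemma symp_of_rows (M : Matrix (Fin (2*n)) (Fin (2*n)) F)
    (h : ∀ i k, symForm F n (M i) (M k) = formMatrix F n i k) : IsSymplectic F n M := by
  have hM : M * formMatrix F n * Mᵀ = formMatrix F n := by
    ext i k
    rw [← h i k, mul_assoc]
    rfl
  intro v w
  unfold symForm
  conv_rhs => rw [← hM]
  rw [← mulVec_transpose M w, ← mulVec_mulVec, ← mulVec_mulVec, dotProduct_mulVec v M]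

/-- basis vector with a natural number index -/
def bV (F : Type) [Field F] (n : ℕ) (k : ℕ) : Fin (2*n) → F := fun j => if (j : ℕ) = k then 1 else 0

lemma bV_eq (k : ℕ) (hk : k < 2*n) : bV F n k = Pi.single ⟨k, hk⟩ 1 := by
  ext j; simp [bV, Pi.single_apply, Fin.ext_iff]

lemma form_bV (a b : ℕ) (ha : a < 2*n) (hb : b < 2*n) :
    symForm F n (bV F n a) (bV F n b) =
      if a + b = 2*n - 1 then (if a < n then (1 : F) else -1) else 0 := by
  rw [bV_eq a ha, bV_eq b hb, symForm_single]
  rfl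

lemma sGen_row (i : Fin (2*n)) : sGen F n i =
    if (i : ℕ) = 0 then bV F n (2*n-1) else if (i : ℕ) = 2*n-1 then - bV F n 0
    else bV F n i := by
  ext j
  simp only [sGen, of_apply, Fin.ext_iff]
  split_ifs <;> simp_all [bV]

lemma tGen_row (hn : 2 ≤ n) (i : Fin (2*n)) : tGen F n i =
    if (i : ℕ) = 0 then bV F n 0 + bV F n (2*n-1) else bV F n i := by
  ext j
  simp only [tGen, of_apply, Fin.ext_iff]
  split_ifs <;> simp_all [bV] <;> split_ifs <;> first | rfl | omega | simp

lemma dGen_row (ω : Fˣ) (i : Fin (2*n)) : dGen F n ω i =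
    if (i : ℕ) = 0 then (ω : F) • bV F n 0 else
    if (i : ℕ) = 2*n-1 then ((ω⁻¹ : Fˣ) : F) • bV F n (2*n-1) else bV F n i := by
  ext j
  simp only [dGen, of_apply, Fin.ext_iff]
  split_ifs <;> simp_all [bV]

lemma uGen_row (i : Fin (2*n)) : uGen F n i =
    if (i : ℕ) = 0 then bV F n 1 else if (i : ℕ) = 1 then bV F n 0
    else if (i : ℕ) = 2*n-1 then bV F n (2*n-2)
    else if (i : ℕ) = 2*n-2 then bV F n (2*n-1) else bV F n i := by
  ext j
  simp only [uGen, of_apply, Fin.ext_iff]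
  split_ifs <;> simp_all [bV]

lemma vGen_row (i : Fin (2*n)) : vGen F n i =
    if (i : ℕ) < n then (if (i : ℕ) + 1 = n then bV F n 0 else bV F n (i+1))
    else if (i : ℕ) = n then bV F n (2*n-1) else bV F n (i-1) := by
  ext j
  simp only [vGen, of_apply]
  by_cases h : (i : ℕ) < n
  · by_cases h' : (i : ℕ) + 1 = n
    · simp [h, h', bV]
    · have : ((i : ℕ) + 1) % n = i + 1 := Nat.mod_eq_of_lt (by omega)
      simp [h, h', this, bV]
  · by_cases h' : (i : ℕ) = n <;> simp [h, h', bV]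

lemma xGen_row (hn : 2 ≤ n) (i : Fin (2*n)) : xGen F n i =
    if (i : ℕ) = 2*n-1 then bV F n (2*n-1) + bV F n 1
    else if (i : ℕ) = 2*n-2 then bV F n (2*n-2) + bV F n 0 else bV F n i := by
  ext j
  simp only [xGen, of_apply, Fin.ext_iff]
  split_ifs <;> simp_all [bV] <;> split_ifs <;> first | rfl | omega | simp

lemma sGen_symp (hn : 2 ≤ n) : IsSymplectic F n (sGen F n) := by
  refine symp_of_rows _ fun i k => ?_
  have hi := i.isLt
  have hk := k.isLt
  rw [sGen_row, sGen_row]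
  simp only [formMatrix, of_apply]
  split_ifs <;> simp (discharger := omega) only [symForm_neg_left, symForm_neg_right, form_bV] <;>
    split_ifs <;> first | omega | simp

lemma tGen_symp (hn : 2 ≤ n) : IsSymplectic F n (tGen F n) := by
  refine symp_of_rows _ fun i k => ?_
  have hi := i.isLt
  have hk := k.isLt
  rw [tGen_row hn, tGen_row hn]
  simp only [formMatrix, of_apply]
  split_ifs <;> simp (discharger := omega) only [symForm_add_left, symForm_add_right, form_bV] <;>
    split_ifs <;> first | omega | simp

lemma dGen_symp (hn : 2 ≤ n) (ω : Fˣ) : IsSymplectic F n (dGen F n ω) := by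
  refine symp_of_rows _ fun i k => ?_
  have hi := i.isLt
  have hk := k.isLt
  rw [dGen_row, dGen_row]
  simp only [formMatrix, of_apply]
  split_ifs <;> simp (discharger := omega) only [symForm_smul_left, symForm_smul_right, form_bV] <;>
    split_ifs <;> first | omega | simp

lemma uGen_row_idx (hn : 2 ≤ n) (i : Fin (2*n)) : ∃ a, a < 2*n ∧ uGen F n i = bV F n a ∧
    (((i : ℕ) = 0 ∧ a = 1) ∨ ((i : ℕ) = 1 ∧ a = 0) ∨ ((i : ℕ) = 2*n-1 ∧ a = 2*n-2) ∨
      ((i : ℕ) = 2*n-2 ∧ a = 2*n-1) ∨ (2 ≤ (i : ℕ) ∧ (i : ℕ) < 2*n-2 ∧ a = i)) := by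
  have hi := i.isLt
  rw [uGen_row]
  split_ifs
  · exact ⟨1, by omega, rfl, by omega⟩
  · exact ⟨0, by omega, rfl, by omega⟩
  · exact ⟨2*n-2, by omega, rfl, by omega⟩
  · exact ⟨2*n-1, by omega, rfl, by omega⟩
  · exact ⟨i, by omega, rfl, by omega⟩

lemma uGen_symp (hn : 2 ≤ n) : IsSymplectic F n (uGen F n) := by
  refine symp_of_rows _ fun i k => ?_
  have hi := i.isLt
  have hk := k.isLt
  obtain ⟨a, ha, ha1, ha2⟩ := uGen_row_idx (F := F) hn i
  obtain ⟨b, hb, hb1, hb2⟩ := uGen_row_idx (F := F) hn k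
  rw [ha1, hb1, form_bV a b ha hb]
  simp only [formMatrix, of_apply]
  have h1 : a + b = 2*n-1 ↔ (i : ℕ) + k = 2*n-1 := by omega
  have h3 : a < n ↔ (i : ℕ) < n := by omega
  simp only [h1, h3]

lemma sum_two_squares_field [Fintype F] (h2 : (2 : F) ≠ 0) (x : F) :
    ∃ a b : F, a ^ 2 + b ^ 2 = x := by
  classical
  have hodd : Fintype.card F % 2 = 1 := by
    apply FiniteField.odd_card_of_char_ne_two
    intro h
    apply h2
    have := ringChar.of_eq h
    exact_mod_cast CharP.cast_eq_zero F 2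
  obtain ⟨a, b, hab⟩ := FiniteField.exists_root_sum_quadratic
    (f := (Polynomial.X ^ 2 : Polynomial F)) (g := Polynomial.X ^ 2 - Polynomial.C x)
    (Polynomial.degree_X_pow 2) (Polynomial.degree_X_pow_sub_C (by decide) _) hodd
  refine ⟨a, b, ?_⟩
  rw [← sub_eq_zero]
  simpa [add_sub_assoc] using hab

lemma vGen_symp (hn : 2 ≤ n) : IsSymplectic F n (vGen F n) := by
  refine symp_of_rows _ fun i k => ?_
  have hi := i.isLt
  have hk := k.isLt
  rw [vGen_row, vGen_row]
  simp only [formMatrix, of_apply]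
  split_ifs <;> simp (discharger := omega) only [form_bV] <;>
    split_ifs <;> first | omega | simp

set_option maxHeartbeats 4000000 in
lemma xGen_symp (hn : 2 ≤ n) : IsSymplectic F n (xGen F n) := by
  refine symp_of_rows _ fun i k => ?_
  have hi := i.isLt
  have hk := k.isLt
  rw [xGen_row hn, xGen_row hn]
  simp only [formMatrix, of_apply]
  split_ifs <;> simp (discharger := omega) only [symForm_add_left, symForm_add_right, form_bV] <;>
    split_ifs <;> first | omega | simp

lemma symp_unit (M : Matrix (Fin (2*n)) (Fin (2*n)) F) (hM : IsSymplectic F n M) :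
    ∃ y : (Matrix (Fin (2*n)) (Fin (2*n)) F)ˣ, y.val = M := by
  have hinj : Function.Injective (fun v => v ᵥ* M) := by
    intro v w hvw
    by_contra hne
    obtain ⟨z, hz⟩ := symForm_nondeg _ (sub_ne_zero.mpr hne)
    rw [← hM, sub_vecMul] at hz
    simp only at hvw
    rw [hvw, sub_self] at hz
    simp [symForm] at hz
  have := vecMul_injective_iff_isUnit.mp hinj
  exact this

lemma conj_TU (h2 : (2 : F) ≠ 0) (g : (Matrix (Fin (2*n)) (Fin (2*n)) F)ˣ)
    (hg : IsSymplectic F n g.val) (v : Fin (2*n) → F) (a : F) :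
    g⁻¹ * TU h2 v a * g = TU h2 (v ᵥ* g.val) a := by
  apply Units.ext
  apply mat_ext
  intro w
  have e1 : (g⁻¹ * TU h2 v a * g).val = (g⁻¹).val * TM v a * g.val := rfl
  have e2 : (TU h2 (v ᵥ* g.val) a).val = TM (v ᵥ* g.val) a := rfl
  rw [e1, e2, ← vecMul_vecMul, ← vecMul_vecMul, vecMul_TM, vecMul_TM, add_vecMul, smul_vecMul,
    vecMul_inv_cancel, ← hg (w ᵥ* (g⁻¹).val) v, vecMul_inv_cancel]

lemma bV_mul (k : ℕ) (hk : k < 2*n) (M : Matrix (Fin (2*n)) (Fin (2*n)) F) :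
    bV F n k ᵥ* M = M ⟨k, hk⟩ := by
  rw [bV_eq k hk, single_one_vecMul]; rfl

lemma eV_eq (i : ℕ) (hi : i < n) : eV F n i hi = bV F n i := by
  rw [bV_eq i (by omega)]; rfl
lemma fV_eq (i : ℕ) (hi : i < n) : fV F n i hi = bV F n (2*n-1-i) := by
  rw [bV_eq (2*n-1-i) (by omega)]; rfl

end Aux

/-- the subgroup of `GL(2n, q)` generated by the six standard generators
`{s, t, δ, u, v, x}` equals `Sp(2n, q)`. -/
theorem standard_generators_generate_Sp
    (F : Type) [Field F] [Fintype F] (hq : Odd (Fintype.card F))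
    (n : ℕ) (hn : 2 ≤ n)
    (ω : Fˣ) (hω : ∀ u : Fˣ, u ∈ Subgroup.zpowers ω) :
    ∀ y : (Matrix (Fin (2*n)) (Fin (2*n)) F)ˣ,
      y ∈ Subgroup.closure {z : (Matrix (Fin (2*n)) (Fin (2*n)) F)ˣ |
            (z : Matrix (Fin (2*n)) (Fin (2*n)) F) = sGen F n ∨
            (z : Matrix (Fin (2*n)) (Fin (2*n)) F) = tGen F n ∨
            (z : Matrix (Fin (2*n)) (Fin (2*n)) F) = dGen F n ω ∨
            (z : Matrix (Fin (2*n)) (Fin (2*n)) F) = uGen F n ∨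
            (z : Matrix (Fin (2*n)) (Fin (2*n)) F) = vGen F n ∨
            (z : Matrix (Fin (2*n)) (Fin (2*n)) F) = xGen F n}
        ↔ IsSymplectic F n (y : Matrix (Fin (2*n)) (Fin (2*n)) F) := by
  have hchar : (2 : F) ≠ 0 := by
    intro h
    have hd : CharP F 2 := CharTwo.of_one_ne_zero_of_two_eq_zero one_ne_zero h
    have hr : ringChar F = 2 := ringChar.eq F 2 |>.symm ▸ rfl
    have := FiniteField.even_card_of_char_two hr
    rw [Nat.odd_iff] at hq
    omega
  have h2 := hchar
  intro y
  set G := Subgroup.closure {z : (Matrix (Fin (2*n)) (Fin (2*n)) F)ˣ |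
            (z : Matrix (Fin (2*n)) (Fin (2*n)) F) = sGen F n ∨
            (z : Matrix (Fin (2*n)) (Fin (2*n)) F) = tGen F n ∨
            (z : Matrix (Fin (2*n)) (Fin (2*n)) F) = dGen F n ω ∨
            (z : Matrix (Fin (2*n)) (Fin (2*n)) F) = uGen F n ∨
            (z : Matrix (Fin (2*n)) (Fin (2*n)) F) = vGen F n ∨
            (z : Matrix (Fin (2*n)) (Fin (2*n)) F) = xGen F n} with hG
  have hsymp : ∀ g ∈ G, IsSymplectic F n g.val := by
    intro g hg
    refine Subgroup.closure_induction (p := fun g _ => IsSymplectic F n g.val)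
      ?_ ?_ ?_ ?_ hg
    · rintro z (h | h | h | h | h | h) <;> rw [h]
      · exact sGen_symp hn
      · exact tGen_symp hn
      · exact dGen_symp hn ω
      · exact uGen_symp hn
      · exact vGen_symp hn
      · exact xGen_symp hn
    · intro v w; simp
    · intro a b _ _ ha hb; exact symp_mul ha hb
    · intro a _ ha; exact symp_inv ha
  refine ⟨hsymp y, fun hy => ?_⟩
  obtain ⟨s, hs⟩ := symp_unit _ (sGen_symp (F := F) hn)
  obtain ⟨t, ht⟩ := symp_unit _ (tGen_symp (F := F) hn)
  obtain ⟨d, hd⟩ := symp_unit _ (dGen_symp (F := F) hn ω)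
  obtain ⟨v, hv⟩ := symp_unit _ (vGen_symp (F := F) hn)
  obtain ⟨x, hx⟩ := symp_unit _ (xGen_symp (F := F) hn)
  have hsG : s ∈ G := Subgroup.subset_closure (Or.inl hs)
  have htG : t ∈ G := Subgroup.subset_closure (Or.inr (Or.inl ht))
  have hdG : d ∈ G := Subgroup.subset_closure (Or.inr (Or.inr (Or.inl hd)))
  have hvG : v ∈ G := Subgroup.subset_closure (Or.inr (Or.inr (Or.inr (Or.inr (Or.inl hv)))))
  have hxG : x ∈ G := Subgroup.subset_closure (Or.inr (Or.inr (Or.inr (Or.inr (Or.inr hx)))))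
  have hTadd : ∀ (w : Fin (2*n) → F) (a b : F), TU h2 w (a + b) = TU h2 w a * TU h2 w b := by
    intro w a b
    apply Units.ext
    exact (TM_mul h2 w a b).symm
  -- transvections along multiples of f_1
  let f : Fin (2*n) → F := bV F n (2*n-1)
  have hf1 : TU h2 f 1 = t := by
    apply Units.ext
    rw [ht]
    apply mat_ext
    intro w
    rw [show (TU h2 f 1).val = TM f 1 from rfl]
    revert w
    suffices TM f 1 = tGen F n by intro w; rw [this]
    ext i j
    have hrow : TM f 1 i = bV F n i ᵥ* TM f 1 := (bV_mul i i.isLt _).symm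
    rw [hrow, vecMul_TM, form_bV _ _ i.isLt (by omega), tGen_row hn]
    have hi := i.isLt
    split_ifs <;> first | omega | simp_all [f]
  have hfd : ∀ c : Fˣ, ((c : F) • f) ᵥ* d.val = ((c * ω⁻¹ : Fˣ) : F) • f := by
    intro c
    rw [smul_vecMul, hd, bV_mul _ (by omega), dGen_row, if_neg (by simp; omega), if_pos rfl,
      smul_smul, Units.val_mul]
  have hunit : ∀ k : ℕ, TU h2 (((ω⁻¹ ^ k : Fˣ) : F) • f) 1 ∈ G := by
    intro k
    induction k with
    | zero => simpa [hf1] using htG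
    | succ k ih =>
      have := G.mul_mem (G.mul_mem (G.inv_mem hdG) ih) hdG
      rw [conj_TU h2 d (hsymp d hdG), hfd, ← pow_succ] at this
      exact this
  have hTsm : ∀ (w : Fin (2*n) → F) (c a : F), TU h2 (c • w) a = TU h2 w (a * c ^ 2) := by
    intro w c a
    apply Units.ext
    apply mat_ext
    intro z
    show z ᵥ* TM _ _ = z ᵥ* TM _ _
    rw [vecMul_TM, vecMul_TM, symForm_smul_right, smul_smul]
    congr 1
    ring_nf
  have hsq : ∀ c : F, TU h2 f (c ^ 2) ∈ G := by
    intro c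
    by_cases hc : c = 0
    · have : TU h2 f (c ^ 2) = 1 := by
        apply Units.ext
        show TM _ _ = 1
        rw [hc, zero_pow two_ne_zero, TM_zero]
      rw [this]; exact G.one_mem
    · have h1 := hω (Units.mk0 c hc)⁻¹
      rw [← mem_powers_iff_mem_zpowers] at h1
      obtain ⟨k, hk⟩ := h1
      have h3 := hunit k
      simp only at hk
      rw [inv_pow, hk, inv_inv, hTsm, one_mul] at h3
      exact h3
  have hfS : ∀ a, TU h2 f a ∈ G := by
    intro a
    obtain ⟨c, e, h⟩ := sum_two_squares_field h2 a
    rw [← h, hTadd]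
    exact G.mul_mem (hsq _) (hsq _)
  let S : Set (Fin (2*n) → F) := {w | ∀ a, TU h2 w a ∈ G}
  have hSG : ∀ w ∈ S, ∀ g ∈ G, w ᵥ* g.val ∈ S := by
    intro w hw g hg a
    rw [← conj_TU h2 g (hsymp g hg)]
    exact G.mul_mem (G.mul_mem (G.inv_mem hg) (hw a)) hg
  have hsm : ∀ (c : F) w, w ∈ S → c • w ∈ S := by
    intro c w hw a
    rw [hTsm]; exact hw _
  have hSadd : ∀ w z, w ∈ S → z ∈ S → symForm F n w z ≠ 0 → w + z ∈ S := by
    intro w z hw hz hwz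
    have := hSG w hw _ (hz (symForm F n w z)⁻¹)
    rw [show (TU h2 z (symForm F n w z)⁻¹).val = TM z (symForm F n w z)⁻¹ from rfl,
      vecMul_TM, inv_mul_cancel₀ hwz, one_smul] at this
    exact this
  have hf0 : bV F n (2*n-1) ∈ S := hfS
  have he0 : bV F n 0 ∈ S := by
    have := hsm (-1) _ (hSG _ hf0 s hsG)
    rw [hs, bV_mul _ (by omega), sGen_row, if_neg (by simp; omega), if_pos rfl] at this
    simpa using this
  have hve : ∀ i, i + 1 < n → bV F n i ᵥ* v.val = bV F n (i+1) := by
    intro i hi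
    rw [hv, bV_mul _ (by omega), vGen_row, if_pos (by simp; omega), if_neg (by simp; omega)]
  have hvf : ∀ i, i + 1 < n → bV F n (2*n-1-i) ᵥ* v.val = bV F n (2*n-1-(i+1)) := by
    intro i hi
    rw [hv, bV_mul _ (by omega), vGen_row, if_neg (by simp; omega), if_neg (by simp; omega)]
    congr 1
  have hl0 : bV F n (2*n-1) + bV F n 1 ∈ S := by
    have := hSG _ hf0 x hxG
    rw [hx, bV_mul _ (by omega), xGen_row hn, if_pos rfl] at this
    exact this
  have hall := all_good h2 hn S hSadd hsm ?_ ?_ ?_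
  · exact symp_mem_of_transvections h2 G (fun w a => hall w a) _ y rfl hy
  · intro i hi
    rw [eV_eq]
    induction i with
    | zero => exact he0
    | succ i ih =>
      rw [← hve i hi]
      exact hSG _ (ih (by omega)) v hvG
  · intro i hi
    rw [fV_eq]
    induction i with
    | zero => exact hf0
    | succ i ih =>
      rw [← hvf i hi]
      exact hSG _ (ih (by omega)) v hvG
  · intro i hi
    rw [fV_eq, eV_eq]
    induction i with
    | zero => exact hl0
    | succ i ih =>
      rw [← hvf i (by omega), ← hve (i+1) hi, ← add_vecMul]
      exact hSG _ (ih (by omega)) v hvG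
end
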